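/- For z₁, z₂, z₃ ∈ ℂ define the Jacobians X₁ = (C₆, C₉, C₁₂), X₂ = (C₆, C₉, 𝔠₁₂), X₃ = (C₆, C₉, C₁₈), X₄ = (C₆, C₁₈, 𝔠₁₂), X₅ = (C₉, C₁₈, 𝔠₁₂), Y₁ = (C₆, C₁₂, 𝔠₁₂), Y₂ = (C₉, C₁₂, 𝔠₁₂), Y₃ = (C₆, C₁₂, C₁₈), Y₄ = (C₉, C₁₂, C₁₈). Then for all z₁, z₂, z₃ ∈ ℂ the following system of algebraic equations of the sixth degree holds: 18·X₁²·Y₄³ + 24·X₁·X₃²·Y₄² + 8·X₃⁴·Y₄ + 27·X₁⁵·X₅ = 0; Y₂·Y₃ = Y₁·Y₄; X₄·Y₄ = X₅·Y₃; X₃·Y₁ − X₂·Y₃ = X₁·X₄. -/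

import Mathlib

noncomputable section

/-- Hessian invariant C₆. -/
def C₆ : ℂ → ℂ → ℂ → ℂ := fun z₁ z₂ z₃ =>
  z₁^6 + z₂^6 + z₃^6 - 10*(z₁^3*z₂^3 + z₂^3*z₃^3 + z₃^3*z₁^3)
/-- Hessian invariant C₉. -/
def C₉ : ℂ → ℂ → ℂ → ℂ := fun z₁ z₂ z₃ =>
  (z₁^3 - z₂^3)*(z₂^3 - z₃^3)*(z₃^3 - z₁^3)
/-- Hessian invariant C₁₂. -/
def C₁₂ : ℂ → ℂ → ℂ → ℂ := fun z₁ z₂ z₃ =>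
  (z₁^3 + z₂^3 + z₃^3)*((z₁^3 + z₂^3 + z₃^3)^3 + 216*z₁^3*z₂^3*z₃^3)
/-- Hessian invariant 𝔠₁₂. -/
def 𝔠₁₂ : ℂ → ℂ → ℂ → ℂ := fun z₁ z₂ z₃ =>
  z₁*z₂*z₃*(27*z₁^3*z₂^3*z₃^3 - (z₁^3 + z₂^3 + z₃^3)^3)
/-- Hessian invariant C₁₈. -/
def C₁₈ : ℂ → ℂ → ℂ → ℂ := fun z₁ z₂ z₃ =>
  (z₁^3 + z₂^3 + z₃^3)^6 - 540*z₁^3*z₂^3*z₃^3*(z₁^3 + z₂^3 + z₃^3)^3 - 5832*z₁^6*z₂^6*z₃^6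

/-- Complex partial derivative in the first variable. -/
def pd₁ (F : ℂ → ℂ → ℂ → ℂ) (z₁ z₂ z₃ : ℂ) : ℂ := deriv (fun t => F t z₂ z₃) z₁
/-- Complex partial derivative in the second variable. -/
def pd₂ (F : ℂ → ℂ → ℂ → ℂ) (z₁ z₂ z₃ : ℂ) : ℂ := deriv (fun t => F z₁ t z₃) z₂
/-- Complex partial derivative in the third variable. -/
def pd₃ (F : ℂ → ℂ → ℂ → ℂ) (z₁ z₂ z₃ : ℂ) : ℂ := deriv (fun t => F z₁ z₂ t) z₃

/-- Jacobian determinant of three functions of (z₁, z₂, z₃). -/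
def jac (F G H : ℂ → ℂ → ℂ → ℂ) (z₁ z₂ z₃ : ℂ) : ℂ :=
  Matrix.det !![pd₁ F z₁ z₂ z₃, pd₂ F z₁ z₂ z₃, pd₃ F z₁ z₂ z₃;
                pd₁ G z₁ z₂ z₃, pd₂ G z₁ z₂ z₃, pd₃ G z₁ z₂ z₃;
                pd₁ H z₁ z₂ z₃, pd₂ H z₁ z₂ z₃, pd₃ H z₁ z₂ z₃]

/-- A function invariant under cyclic permutations of the variables has its second partial
derivative determined by the first. -/
theorem pd₂_eq_pd₁_of_cyclic {F : ℂ → ℂ → ℂ → ℂ} (hF : ∀ x y z, F x y z = F y z x) (x y z : ℂ) :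
    pd₂ F x y z = pd₁ F y z x := by
  simp only [pd₁, pd₂, hF x]

/-- A function invariant under cyclic permutations of the variables has its third partial
derivative determined by the first. -/
theorem pd₃_eq_pd₁_of_cyclic {F : ℂ → ℂ → ℂ → ℂ} (hF : ∀ x y z, F x y z = F y z x) (x y z : ℂ) :
    pd₃ F x y z = pd₁ F z x y := by
  simp only [pd₁, pd₃, fun t => (hF t x y).symm]

/-- The Jacobian determinant of three cyclically invariant functions, in terms of their first
partial derivatives. -/
theorem jac_of_cyclic {F G H : ℂ → ℂ → ℂ → ℂ} (hF : ∀ x y z, F x y z = F y z x)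
    (hG : ∀ x y z, G x y z = G y z x) (hH : ∀ x y z, H x y z = H y z x) (x y z : ℂ) :
    jac F G H x y z =
      pd₁ F x y z * (pd₁ G y z x * pd₁ H z x y - pd₁ G z x y * pd₁ H y z x) -
      pd₁ F y z x * (pd₁ G x y z * pd₁ H z x y - pd₁ G z x y * pd₁ H x y z) +
      pd₁ F z x y * (pd₁ G x y z * pd₁ H y z x - pd₁ G y z x * pd₁ H x y z) := by
  rw [jac, Matrix.det_fin_three]
  simp only [Matrix.of_apply, Matrix.cons_val, pd₂_eq_pd₁_of_cyclic hF, pd₃_eq_pd₁_of_cyclic hF,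
    pd₂_eq_pd₁_of_cyclic hG, pd₃_eq_pd₁_of_cyclic hG, pd₂_eq_pd₁_of_cyclic hH,
    pd₃_eq_pd₁_of_cyclic hH]
  ring

theorem C₆_cyclic (x y z : ℂ) : C₆ x y z = C₆ y z x := by
  simp only [C₆]; ring

theorem pd₁_C₆ (x y z : ℂ) :
    pd₁ C₆ x y z = 6 * x^5 - 30 * x^2 * (y^3 + z^3) := by
  simp (disch := fun_prop) only [pd₁, C₆, deriv_fun_add, deriv_fun_sub, deriv_fun_mul,
    deriv_fun_pow, deriv_const, deriv_id'']
  push_cast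
  ring

theorem C₉_cyclic (x y z : ℂ) : C₉ x y z = C₉ y z x := by
  simp only [C₉]; ring

theorem pd₁_C₉ (x y z : ℂ) :
    pd₁ C₉ x y z = 3 * x^2 * (y^3 - z^3) * (z^3 + y^3 - 2 * x^3) := by
  simp (disch := fun_prop) only [pd₁, C₉, deriv_fun_sub, deriv_fun_mul,
    deriv_fun_pow, deriv_const, deriv_id'']
  push_cast
  ring

theorem C₁₂_cyclic (x y z : ℂ) : C₁₂ x y z = C₁₂ y z x := by
  simp only [C₁₂]; ring

theorem pd₁_C₁₂ (x y z : ℂ) :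
    pd₁ C₁₂ x y z = 12 * x^2 * ((x^3 + y^3 + z^3)^3 + 54 * (y*z)^3 * (2 * x^3 + y^3 + z^3)) := by
  simp (disch := fun_prop) only [pd₁, C₁₂, deriv_fun_add, deriv_fun_mul,
    deriv_fun_pow, deriv_const, deriv_id'']
  push_cast
  ring

theorem 𝔠₁₂_cyclic (x y z : ℂ) : 𝔠₁₂ x y z = 𝔠₁₂ y z x := by
  simp only [𝔠₁₂]; ring

theorem pd₁_𝔠₁₂ (x y z : ℂ) :
    pd₁ 𝔠₁₂ x y z = y * z * (108 * (x*y*z)^3 - (x^3 + y^3 + z^3)^2 * (10 * x^3 + y^3 + z^3)) := by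
  simp (disch := fun_prop) only [pd₁, 𝔠₁₂, deriv_fun_add, deriv_fun_sub, deriv_fun_mul,
    deriv_fun_pow, deriv_const, deriv_id'']
  push_cast
  ring

theorem C₁₈_cyclic (x y z : ℂ) : C₁₈ x y z = C₁₈ y z x := by
  simp only [C₁₈]; ring

theorem pd₁_C₁₈ (x y z : ℂ) :
    pd₁ C₁₈ x y z = 18 * x^2 * ((x^3 + y^3 + z^3)^5
        - 90 * (y*z)^3 * (x^3 + y^3 + z^3)^2 * (4 * x^3 + y^3 + z^3)
        - 1944 * x^3 * (y*z)^6) := by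
  simp (disch := fun_prop) only [pd₁, C₁₈, deriv_fun_add, deriv_fun_sub, deriv_fun_mul,
    deriv_fun_pow, deriv_const, deriv_id'']
  push_cast
  ring

theorem jac_C₆_C₉_C₁₂ (x y z : ℂ) :
    jac C₆ C₉ C₁₂ x y z = -2592 * 𝔠₁₂ x y z ^ 2 := by
  simp only [jac_of_cyclic C₆_cyclic C₉_cyclic C₁₂_cyclic,
    pd₁_C₆, pd₁_C₉, pd₁_C₁₂, 𝔠₁₂]
  ring

theorem jac_C₆_C₉_𝔠₁₂ (x y z : ℂ) :
    jac C₆ C₉ 𝔠₁₂ x y z = -(3 / 2) * (C₆ x y z * C₁₈ x y z - C₁₂ x y z ^ 2) := by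
  simp only [jac_of_cyclic C₆_cyclic C₉_cyclic 𝔠₁₂_cyclic,
    pd₁_C₆, pd₁_C₉, pd₁_𝔠₁₂, C₁₂, C₁₈, C₆]
  ring

theorem jac_C₆_C₉_C₁₈ (x y z : ℂ) :
    jac C₆ C₉ C₁₈ x y z = -3888 * C₆ x y z * 𝔠₁₂ x y z ^ 2 := by
  simp only [jac_of_cyclic C₆_cyclic C₉_cyclic C₁₈_cyclic,
    pd₁_C₆, pd₁_C₉, pd₁_C₁₈, C₆, 𝔠₁₂]
  ring

theorem jac_C₆_C₁₈_𝔠₁₂ (x y z : ℂ) :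
    jac C₆ C₁₈ 𝔠₁₂ x y z = 648 * C₉ x y z * C₁₂ x y z ^ 2 := by
  simp only [jac_of_cyclic C₆_cyclic C₁₈_cyclic 𝔠₁₂_cyclic,
    pd₁_C₆, pd₁_C₁₈, pd₁_𝔠₁₂, C₁₂, C₉]
  ring

theorem jac_C₉_C₁₈_𝔠₁₂ (x y z : ℂ) :
    jac C₉ C₁₈ 𝔠₁₂ x y z = 9 / 4 * C₁₂ x y z ^ 2 * (C₆ x y z ^ 2 - C₁₂ x y z) := by
  simp only [jac_of_cyclic C₉_cyclic C₁₈_cyclic 𝔠₁₂_cyclic,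
    pd₁_C₉, pd₁_C₁₈, pd₁_𝔠₁₂, C₁₂, C₆]
  ring

theorem jac_C₆_C₁₂_𝔠₁₂ (x y z : ℂ) :
    jac C₆ C₁₂ 𝔠₁₂ x y z = 432 * C₉ x y z * C₁₈ x y z := by
  simp only [jac_of_cyclic C₆_cyclic C₁₂_cyclic 𝔠₁₂_cyclic,
    pd₁_C₆, pd₁_C₁₂, pd₁_𝔠₁₂, C₁₈, C₉]
  ring

theorem jac_C₉_C₁₂_𝔠₁₂ (x y z : ℂ) :
    jac C₉ C₁₂ 𝔠₁₂ x y z = 3 / 2 * C₁₈ x y z * (C₆ x y z ^ 2 - C₁₂ x y z) := by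
  simp only [jac_of_cyclic C₉_cyclic C₁₂_cyclic 𝔠₁₂_cyclic,
    pd₁_C₉, pd₁_C₁₂, pd₁_𝔠₁₂, C₁₂, C₁₈, C₆]
  ring

theorem jac_C₆_C₁₂_C₁₈ (x y z : ℂ) :
    jac C₆ C₁₂ C₁₈ x y z = 1119744 * C₉ x y z * 𝔠₁₂ x y z ^ 2 := by
  simp only [jac_of_cyclic C₆_cyclic C₁₂_cyclic C₁₈_cyclic,
    pd₁_C₆, pd₁_C₁₂, pd₁_C₁₈, C₉, 𝔠₁₂]
  ring

theorem jac_C₉_C₁₂_C₁₈ (x y z : ℂ) :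
    jac C₉ C₁₂ C₁₈ x y z = 3888 * (C₆ x y z ^ 2 - C₁₂ x y z) * 𝔠₁₂ x y z ^ 2 := by
  simp only [jac_of_cyclic C₉_cyclic C₁₂_cyclic C₁₈_cyclic,
    pd₁_C₉, pd₁_C₁₂, pd₁_C₁₈, C₁₂, C₆, 𝔠₁₂]
  ring

theorem sixth_degree_system (z₁ z₂ z₃ : ℂ)
    (X₁ X₂ X₃ X₄ X₅ Y₁ Y₂ Y₃ Y₄ : ℂ)
    (hX₁ : X₁ = jac C₆ C₉ C₁₂ z₁ z₂ z₃)
    (hX₂ : X₂ = jac C₆ C₉ 𝔠₁₂ z₁ z₂ z₃)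
    (hX₃ : X₃ = jac C₆ C₉ C₁₈ z₁ z₂ z₃)
    (hX₄ : X₄ = jac C₆ C₁₈ 𝔠₁₂ z₁ z₂ z₃)
    (hX₅ : X₅ = jac C₉ C₁₈ 𝔠₁₂ z₁ z₂ z₃)
    (hY₁ : Y₁ = jac C₆ C₁₂ 𝔠₁₂ z₁ z₂ z₃)
    (hY₂ : Y₂ = jac C₉ C₁₂ 𝔠₁₂ z₁ z₂ z₃)
    (hY₃ : Y₃ = jac C₆ C₁₂ C₁₈ z₁ z₂ z₃)
    (hY₄ : Y₄ = jac C₉ C₁₂ C₁₈ z₁ z₂ z₃) :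
    18*X₁^2*Y₄^3 + 24*X₁*X₃^2*Y₄^2 + 8*X₃^4*Y₄ + 27*X₁^5*X₅ = 0 ∧
    Y₂*Y₃ = Y₁*Y₄ ∧
    X₄*Y₄ = X₅*Y₃ ∧
    X₃*Y₁ - X₂*Y₃ = X₁*X₄ := by
  subst hX₁ hX₂ hX₃ hX₄ hX₅ hY₁ hY₂ hY₃ hY₄
  rw [jac_C₆_C₉_C₁₂, jac_C₆_C₉_𝔠₁₂, jac_C₆_C₉_C₁₈, jac_C₆_C₁₈_𝔠₁₂,
    jac_C₉_C₁₈_𝔠₁₂, jac_C₆_C₁₂_𝔠₁₂, jac_C₉_C₁₂_𝔠₁₂, jac_C₆_C₁₂_C₁₈,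
    jac_C₉_C₁₂_C₁₈]
  refine ⟨?_, ?_, ?_, ?_⟩ <;> ring
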